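/- Let h ∈ F_2^n be a word of weight w and e a uniformly random error of weight t, with w = O(√n) and t = O(√n). Then P(⟨h,e⟩ = 1) = 1/2 - (1/2)·e^{-2wt/n}·(1 + O(1/√n)) as n → ∞. -/

import Mathlib

open Finset

namespace ParityAux

noncomputable def chi (x : ZMod 2) : ℝ := if x = 1 then -1 else 1

lemma chi_zero : chi 0 = 1 := by simp [chi]

lemma zmod2_cases (x : ZMod 2) : x = 0 ∨ x = 1 := by
  revert x; decide

lemma chi_add (x y : ZMod 2) : chi (x + y) = chi x * chi y := by
  have h2 : (1 : ZMod 2) + 1 = 0 := by decide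
  rcases zmod2_cases x with rfl | rfl <;> rcases zmod2_cases y with rfl | rfl <;>
    simp [chi, h2]

lemma chi_sq (x : ZMod 2) : chi x * chi x = 1 := by
  unfold chi; split_ifs <;> norm_num

lemma chi_abs (x : ZMod 2) : |chi x| = 1 := by
  unfold chi; split_ifs <;> norm_num

lemma chi_sum {ι : Type*} (s : Finset ι) (f : ι → ZMod 2) :
    chi (∑ i ∈ s, f i) = ∏ i ∈ s, chi (f i) := by
  classical
  induction s using Finset.induction_on with
  | empty => simp [chi]
  | insert a s ha ih => rw [Finset.sum_insert ha, Finset.prod_insert ha, chi_add, ih]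

lemma chi_mul (x y : ZMod 2) : chi (x * y) = if y = 1 then chi x else 1 := by
  rcases zmod2_cases y with rfl | rfl <;> simp [chi_zero]

/-- signed count of t-subsets -/
noncomputable def A {n : ℕ} (h : Fin n → ZMod 2) (t : ℕ) : ℝ :=
  ∑ S ∈ Finset.powersetCard t (Finset.univ : Finset (Fin n)), ∏ i ∈ S, chi (h i)

lemma sum_e {n : ℕ} (t : ℕ) (f : Finset (Fin n) → ℝ) :
    ∑ e ∈ Finset.univ.filter (fun e : Fin n → ZMod 2 =>
        (Finset.univ.filter (fun i : Fin n => e i = 1)).card = t),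
      f (Finset.univ.filter (fun i : Fin n => e i = 1)) =
    ∑ S ∈ Finset.powersetCard t (Finset.univ : Finset (Fin n)), f S := by
  refine Finset.sum_bij' (fun e _ => Finset.univ.filter (fun i : Fin n => e i = 1))
    (fun S _ => fun i => if i ∈ S then 1 else 0) ?_ ?_ ?_ ?_ ?_
  · intro e he
    simpa [Finset.mem_powersetCard] using he
  · intro S hS
    simpa [Finset.mem_powersetCard] using hS
  · intro e he
    funext i
    rcases zmod2_cases (e i) with h | h <;> simp [h]
  · intro S hS
    ext i
    simp
  · intro e he
    rfl

lemma count_eq {n : ℕ} (h : Fin n → ZMod 2) (t : ℕ) :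
    ((Finset.univ.filter (fun e : Fin n → ZMod 2 =>
            (Finset.univ.filter (fun i : Fin n => e i = 1)).card = t ∧
              (∑ i : Fin n, h i * e i) = 1)).card : ℝ) = ((n.choose t : ℝ) - A h t) / 2 := by
  have h1 := sum_e (n := n) t (fun _ => 1)
  have h2 := sum_e (n := n) t (fun S => ∏ i ∈ S, chi (h i))
  have h3 : ∀ e : Fin n → ZMod 2, ∏ i ∈ Finset.univ.filter (fun i : Fin n => e i = 1), chi (h i)
      = chi (∑ i : Fin n, h i * e i) := by
    intro e
    rw [chi_sum, Finset.prod_filter]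
    exact Finset.prod_congr rfl fun i _ => (chi_mul _ _).symm
  have h4 : (∑ S ∈ Finset.powersetCard t (Finset.univ : Finset (Fin n)), (1:ℝ)) = n.choose t := by
    simp
  rw [h4] at h1
  simp only [h3] at h2
  rw [A, ← h2, ← h1, ← Finset.sum_sub_distrib, ← Finset.filter_filter, Finset.card_filter,
    Finset.sum_div]
  push_cast
  refine Finset.sum_congr rfl fun e _ => ?_
  unfold chi
  split_ifs <;> norm_num

lemma A_abs {n : ℕ} (h : Fin n → ZMod 2) (t : ℕ) : |A h t| ≤ n.choose t := by
  unfold A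
  refine (Finset.abs_sum_le_sum_abs _ _).trans ?_
  simp [Finset.abs_prod, chi_abs]

open Polynomial in
noncomputable def P {ι : Type*} (s : Finset ι) (f : ι → ℝ) : ℝ[X] :=
  ∏ i ∈ s, (1 + C (f i) * X)

open Polynomial in
lemma P_coeff {ι : Type*} [DecidableEq ι] (s : Finset ι) (f : ι → ℝ) (t : ℕ) :
    (P s f).coeff t = ∑ S ∈ s.powersetCard t, ∏ i ∈ S, f i := by
  unfold P
  rw [Finset.prod_one_add, finsetSum_coeff, Finset.powersetCard_eq_filter, Finset.sum_filter]
  refine Finset.sum_congr rfl fun S _ => ?_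
  rw [Finset.prod_mul_distrib, Finset.prod_const, ← map_prod, coeff_C_mul, coeff_X_pow]
  by_cases hS : S.card = t <;> simp [hS, eq_comm]
  intro h
  exact absurd h.symm hS

open Polynomial in
lemma P_deriv {ι : Type*} [DecidableEq ι] (s : Finset ι) (f : ι → ℝ) (hf : ∀ i, f i * f i = 1) :
    (1 - X ^ 2) * derivative (P s f) = (C (∑ i ∈ s, f i) - C (s.card : ℝ) * X) * P s f := by
  induction s using Finset.induction_on with
  | empty => simp [P]
  | insert a s ha ih =>
    have hP : P (insert a s) f = (1 + C (f a) * X) * P s f := by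
      unfold P; rw [Finset.prod_insert ha]
    have hc : (C (f a) : ℝ[X]) * C (f a) = 1 := by rw [← C_mul, hf, C_1]
    rw [hP, Finset.sum_insert ha, Finset.card_insert_of_notMem ha]
    simp only [derivative_mul, derivative_add, derivative_one, derivative_C, derivative_X,
      C_add, Nat.cast_add, Nat.cast_one, C_1]
    linear_combination (1 + C (f a) * X) * ih + (-X * P s f) * hc

open Polynomial in
lemma P_rec {ι : Type*} [DecidableEq ι] (s : Finset ι) (f : ι → ℝ) (hf : ∀ i, f i * f i = 1)
    (t : ℕ) :
    ((t : ℝ) + 2) * (P s f).coeff (t + 2) = (∑ i ∈ s, f i) * (P s f).coeff (t + 1)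
      - ((s.card : ℝ) - t) * (P s f).coeff t := by
  have h := congrArg (fun p => Polynomial.coeff p (t + 1)) (P_deriv s f hf)
  have e1 : (1 - X ^ 2) * derivative (P s f) =
    derivative (P s f) - (X * derivative (P s f)) * X := by ring
  have e2 : (C (∑ i ∈ s, f i) - C (s.card : ℝ) * X) * P s f =
    C (∑ i ∈ s, f i) * P s f - C (s.card : ℝ) * (P s f * X) := by ring
  simp only [e1, e2, coeff_sub, coeff_mul_X, coeff_C_mul, coeff_derivative] at h
  have h5 : (X * derivative (P s f)).coeff t = t * (P s f).coeff t := by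
    cases t with
    | zero => simp
    | succ k => rw [coeff_X_mul, coeff_derivative]; push_cast; ring
  rw [h5] at h
  push_cast at h
  linarith

lemma sum_chi {n : ℕ} (h : Fin n → ZMod 2) :
    ∑ i, chi (h i) = (n : ℝ) - 2 * ((Finset.univ.filter (fun i : Fin n => h i = 1)).card : ℝ) := by
  rw [Finset.card_filter]
  push_cast
  have : (n : ℝ) = ∑ i : Fin n, (1 : ℝ) := by simp
  rw [this, Finset.mul_sum, ← Finset.sum_sub_distrib]
  refine Finset.sum_congr rfl fun i _ => ?_
  unfold chi
  split_ifs <;> norm_num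

lemma A_rec {n : ℕ} (h : Fin n → ZMod 2) (t : ℕ) :
    ((t : ℝ) + 2) * A h (t + 2) =
      ((n : ℝ) - 2 * ((Finset.univ.filter (fun i : Fin n => h i = 1)).card : ℝ)) * A h (t + 1)
      - ((n : ℝ) - t) * A h t := by
  have := P_rec (Finset.univ : Finset (Fin n)) (fun i => chi (h i)) (fun i => chi_sq _) t
  simp only [P_coeff, sum_chi, Finset.card_univ, Fintype.card_fin] at this
  exact this

lemma A_zero {n : ℕ} (h : Fin n → ZMod 2) : A h 0 = 1 := by simp [A]

lemma A_one {n : ℕ} (h : Fin n → ZMod 2) : A h 1 =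
    (n : ℝ) - 2 * ((Finset.univ.filter (fun i : Fin n => h i = 1)).card : ℝ) := by
  rw [← sum_chi]
  simp [A, Finset.powersetCard_one]

lemma delta_rec {n : ℕ} (h : Fin n → ZMod 2) (t : ℕ) (ht : t + 2 ≤ n) :
    ((n : ℝ) - t - 1) * (A h (t + 2) / n.choose (t + 2)) =
      ((n : ℝ) - 2 * ((Finset.univ.filter (fun i : Fin n => h i = 1)).card : ℝ))
        * (A h (t + 1) / n.choose (t + 1))
      - ((t : ℝ) + 1) * (A h t / n.choose t) := by
  have h0 := A_rec h t
  have c0 : (n.choose t : ℝ) ≠ 0 := by exact_mod_cast (Nat.choose_pos (by omega)).ne'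
  have c1 : (n.choose (t + 1) : ℝ) ≠ 0 := by exact_mod_cast (Nat.choose_pos (by omega)).ne'
  have c2 : (n.choose (t + 2) : ℝ) ≠ 0 := by exact_mod_cast (Nat.choose_pos (by omega)).ne'
  have r1 : (n.choose (t + 1) : ℝ) * (t + 1) = n.choose t * ((n : ℝ) - t) := by
    have := Nat.choose_succ_right_eq n t
    have h := congrArg (Nat.cast (R := ℝ)) this
    push_cast [Nat.cast_sub (show t ≤ n by omega)] at h
    exact h
  have r2 : (n.choose (t + 2) : ℝ) * (t + 2) = n.choose (t + 1) * ((n : ℝ) - t - 1) := by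
    have := Nat.choose_succ_right_eq n (t + 1)
    have h := congrArg (Nat.cast (R := ℝ)) this
    push_cast [Nat.cast_sub (show t + 1 ≤ n by omega)] at h
    linarith
  have q2 : ((n : ℝ) - t - 1) * (A h (t + 2) / n.choose (t + 2)) =
      ((t : ℝ) + 2) * A h (t + 2) / n.choose (t + 1) := by
    field_simp
    linear_combination (-A h (t + 2)) * r2
  have q0 : ((t : ℝ) + 1) * (A h t / n.choose t) =
      ((n : ℝ) - t) * A h t / n.choose (t + 1) := by
    field_simp
    linear_combination (A h t) * r1
  rw [q2, q0, h0]
  ring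

lemma real_step (d : ℕ → ℝ) (n W : ℝ) (T : ℕ) (hn : 0 < n) (hW : 0 ≤ W)
    (hT : 4 * (T : ℝ) ≤ n) (hb : ∀ t, t ≤ T → |d t| ≤ 1) (h0 : d 0 = 1)
    (h1 : 1 ≤ T → n * d 1 = n - 2 * W)
    (hr : ∀ t : ℕ, t + 2 ≤ T →
      (n - t - 1) * d (t + 2) = (n - 2 * W) * d (t + 1) - ((t : ℝ) + 1) * d t) :
    ∀ t : ℕ, t + 1 ≤ T → n * |d (t + 1) - d t| ≤ 4 * W ∧
      n * (n * |d (t + 1) - (1 - 2 * W / n) * d t|) ≤ 8 * W * T := by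
  intro t
  induction t with
  | zero =>
    intro ht
    have e := h1 ht
    have e' : d 1 = 1 - 2 * W / n := by field_simp; linarith
    constructor
    · rw [zero_add, h0]
      have : d 1 - 1 = -(2 * W / n) := by rw [e']; ring
      rw [this, abs_neg, abs_of_nonneg (by positivity)]
      have : n * (2 * W / n) = 2 * W := by field_simp
      rw [this]; linarith
    · rw [zero_add, h0, e']
      simp
      positivity
  | succ t ih =>
    intro ht
    obtain ⟨ih1, -⟩ := ih (by omega)
    have hr' := hr t ht
    have hTt : (t : ℝ) + 2 ≤ T := by exact_mod_cast ht
    have ht0 : (0 : ℝ) ≤ t := Nat.cast_nonneg t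
    have hd := hb (t + 1) (by omega)
    set x := d (t + 1 + 1) - d (t + 1) with hx
    set y := d (t + 1) - d t with hy
    have key : (n - t - 1) * x = -2 * W * d (t + 1) + (t + 1) * y := by
      rw [hx, hy]; linear_combination hr'
    have hp : 0 < n - t - 1 := by linarith
    have hab : (n - t - 1) * |x| ≤ 2 * W + (t + 1) * |y| := by
      rw [← abs_of_pos hp, ← abs_mul, key]
      refine (abs_add_le _ _).trans ?_
      rw [abs_mul, abs_mul, abs_mul, abs_of_nonneg (show (0:ℝ) ≤ t + 1 by positivity),
        abs_of_nonneg hW]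
      norm_num
      nlinarith [abs_nonneg (d (t+1))]
    have hx0 := abs_nonneg x
    have hy0 := abs_nonneg y
    have hy1 : (t + 1) * |y| ≤ W := by nlinarith
    have hx1 : n * |x| ≤ 4 * W := by nlinarith
    refine ⟨hx1, ?_⟩
    have e : n * (d (t + 1 + 1) - (1 - 2 * W / n) * d (t + 1)) = (t + 1) * x + (t + 1) * y := by
      have : n * (d (t + 1 + 1) - (1 - 2 * W / n) * d (t + 1)) = n * x + 2 * W * d (t + 1) := by
        rw [hx]; field_simp; ring
      rw [this]; linear_combination key
    have e2 : n * |d (t + 1 + 1) - (1 - 2 * W / n) * d (t + 1)| ≤ (t + 1) * |x| + (t + 1) * |y| := by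
      rw [← abs_of_pos hn, ← abs_mul, abs_of_pos hn, e]
      refine (abs_add_le _ _).trans ?_
      rw [abs_mul, abs_mul, abs_of_nonneg (show (0:ℝ) ≤ t + 1 by positivity)]
    calc n * (n * |d (t + 1 + 1) - (1 - 2 * W / n) * d (t + 1)|)
        ≤ n * ((t + 1) * |x| + (t + 1) * |y|) := by gcongr
      _ = (t + 1) * (n * |x| + n * |y|) := by ring
      _ ≤ (t + 1) * (4 * W + 4 * W) := by gcongr
      _ ≤ T * (4 * W + 4 * W) := by gcongr; linarith
      _ = 8 * W * T := by ring

lemma real_main (d : ℕ → ℝ) (n W : ℝ) (T : ℕ) (hn : 0 < n) (hW : 0 ≤ W) (hWn : 2 * W ≤ n)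
    (hT : 4 * (T : ℝ) ≤ n) (hb : ∀ t, t ≤ T → |d t| ≤ 1) (h0 : d 0 = 1)
    (h1 : 1 ≤ T → n * d 1 = n - 2 * W)
    (hr : ∀ t : ℕ, t + 2 ≤ T →
      (n - t - 1) * d (t + 2) = (n - 2 * W) * d (t + 1) - ((t : ℝ) + 1) * d t) :
    ∀ t : ℕ, t ≤ T →
      |d t - Real.exp (-(2 * W / n)) ^ t| ≤ t * ((8 * W * T + 4 * W ^ 2) / n ^ 2) := by
  have hs := real_step d n W T hn hW hT hb h0 h1 hr
  intro t
  induction t with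
  | zero => intro _; simp [h0]
  | succ t ih =>
    intro ht
    have ih := ih (by omega)
    have hs := (hs t ht).2
    have hd := hb t (by omega)
    set q := Real.exp (-(2 * W / n)) with hq
    have hq0 : 0 < q := Real.exp_pos _
    have hz : 0 ≤ 2 * W / n := by positivity
    have hq1 : q ≤ 1 := by rw [hq]; apply Real.exp_le_one_iff.2; linarith
    have hz1 : 2 * W / n ≤ 1 := by rw [div_le_one hn]; exact hWn
    have hexp := Real.abs_exp_sub_one_sub_id_le (x := -(2 * W / n))
      (by rw [abs_neg, abs_of_nonneg hz]; exact hz1)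
    rw [← hq] at hexp
    have hexp' : |(1 - 2 * W / n - q) * d t| ≤ 4 * W ^ 2 / n ^ 2 := by
      rw [abs_mul]
      have : |1 - 2 * W / n - q| ≤ 4 * W ^ 2 / n ^ 2 := by
        rw [← abs_neg]
        convert hexp using 2 <;> ring
      calc _ ≤ 4 * W ^ 2 / n ^ 2 * 1 := by gcongr
        _ = _ := by ring
    have hs' : |d (t + 1) - (1 - 2 * W / n) * d t| ≤ 8 * W * T / n ^ 2 := by
      rw [le_div_iff₀ (by positivity)]; linarith
    have e : d (t + 1) - q ^ (t + 1) = (d (t + 1) - (1 - 2 * W / n) * d t)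
        + (1 - 2 * W / n - q) * d t + q * (d t - q ^ t) := by ring
    have hq2 : |q * (d t - q ^ t)| ≤ |d t - q ^ t| := by
      rw [abs_mul, abs_of_pos hq0]
      exact mul_le_of_le_one_left (abs_nonneg _) hq1
    rw [e]
    have := abs_add_three (d (t + 1) - (1 - 2 * W / n) * d t)
      ((1 - 2 * W / n - q) * d t) (q * (d t - q ^ t))
    push_cast
    rw [add_mul, one_mul, add_div] at *
    linarith

end ParityAux


/-- For `h ∈ F_2^n` of weight `w` and a uniformly random error `e` of
weight `t`, with `w = O(√n)` and `t = O(√n)`, we have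
`P(⟨h,e⟩ = 1) = 1/2 - (1/2)·e^{-2wt/n}·(1 + O(1/√n))` as `n → ∞`. -/
theorem prob_parity_check_asymptotic (C : ℝ) (hC : 0 < C) :
    ∃ D : ℝ, 0 < D ∧ ∃ N : ℕ, ∀ n : ℕ, N ≤ n → ∀ w t : ℕ, ∀ h : Fin n → ZMod 2,
      (Finset.univ.filter (fun i : Fin n => h i = 1)).card = w →
      (w : ℝ) ≤ C * Real.sqrt n → (t : ℝ) ≤ C * Real.sqrt n → t ≤ n →
      ∃ θ : ℝ, |θ| ≤ D / Real.sqrt n ∧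
        ((Finset.univ.filter (fun e : Fin n → ZMod 2 =>
            (Finset.univ.filter (fun i : Fin n => e i = 1)).card = t ∧
              (∑ i : Fin n, h i * e i) = 1)).card : ℝ) / (n.choose t : ℝ)
          = 1/2 - (1/2) * Real.exp (-(2 * (w : ℝ) * t) / n) * (1 + θ) := by
  refine ⟨12 * C ^ 3 * Real.exp (2 * C ^ 2), by positivity, ⌈16 * C ^ 2⌉₊ + 1, ?_⟩
  intro n hN w t h hw hwC htC htn
  have hN' : 16 * C ^ 2 ≤ n := by
    have h1 := Nat.le_ceil (16 * C ^ 2)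
    have h2 : ((⌈16 * C ^ 2⌉₊ : ℕ) : ℝ) ≤ n := by exact_mod_cast (by omega : ⌈16 * C ^ 2⌉₊ ≤ n)
    linarith
  have hn : (0 : ℝ) < n := by exact_mod_cast (by omega : 0 < n)
  set r := Real.sqrt n with hr
  have hr0 : 0 < r := Real.sqrt_pos.2 hn
  have hrr : r * r = n := Real.mul_self_sqrt hn.le
  have hrC : 4 * C ≤ r := Real.le_sqrt_of_sq_le (by linarith)
  have hCr : 4 * (C * r) ≤ n := by nlinarith
  have hw0 : (0 : ℝ) ≤ w := Nat.cast_nonneg w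
  have ht0 : (0 : ℝ) ≤ t := Nat.cast_nonneg t
  have main := ParityAux.real_main (fun k => ParityAux.A h k / n.choose k) n w t hn hw0
    (by linarith) (by linarith)
    (fun k hk => by
      have hp : (0 : ℝ) < n.choose k := by exact_mod_cast Nat.choose_pos (by omega)
      rw [abs_div, abs_of_pos hp, div_le_one hp]
      exact ParityAux.A_abs h k)
    (by simp [ParityAux.A_zero])
    (fun _ => by
      simp only [ParityAux.A_one, Nat.choose_one_right, hw]
      field_simp)
    (fun k hk => by
      have := ParityAux.delta_rec h k (by omega)
      rw [hw] at this
      exact this) t le_rfl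
  have hc : (0 : ℝ) < n.choose t := by exact_mod_cast Nat.choose_pos htn
  rw [← Real.exp_nat_mul] at main
  have ee : (t : ℝ) * -(2 * (w : ℝ) / n) = -(2 * (w : ℝ) * t) / n := by ring
  rw [ee] at main
  set δ := ParityAux.A h t / n.choose t with hδ
  set E := Real.exp (-(2 * (w : ℝ) * t) / n) with hE
  have hE0 : 0 < E := Real.exp_pos _
  have hwt : (w : ℝ) * t ≤ C ^ 2 * n := by
    calc (w : ℝ) * t ≤ (C * r) * (C * r) := by gcongr
      _ = C ^ 2 * (r * r) := by ring
      _ = _ := by rw [hrr]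
  have hEl : 1 ≤ E * Real.exp (2 * C ^ 2) := by
    rw [hE, ← Real.exp_add]
    apply Real.one_le_exp
    rw [neg_div, neg_add_eq_sub, sub_nonneg, div_le_iff₀ hn]
    linarith
  have hbound : (t : ℝ) * ((8 * w * t + 4 * (w : ℝ) ^ 2) / (n : ℝ) ^ 2) ≤ 12 * C ^ 3 / r := by
    calc (t : ℝ) * ((8 * w * t + 4 * (w : ℝ) ^ 2) / (n : ℝ) ^ 2)
        ≤ (C * r) * ((8 * (C * r) * (C * r) + 4 * (C * r) ^ 2) / (n : ℝ) ^ 2) := by gcongr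
      _ = _ := by rw [← hrr]; field_simp; ring
  refine ⟨δ / E - 1, ?_, ?_⟩
  · have : δ / E - 1 = (δ - E) / E := by field_simp
    rw [this, abs_div, abs_of_pos hE0, div_le_iff₀ hE0]
    calc |δ - E| ≤ 12 * C ^ 3 / r * 1 := by linarith
      _ ≤ 12 * C ^ 3 / r * (E * Real.exp (2 * C ^ 2)) := by gcongr
      _ = _ := by ring
  · rw [ParityAux.count_eq, hδ]
    field_simp
    ring
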